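/- Let μ > 0 and ρ > 0, and let x > 0. Then G(x, μ/x; μ, ρ) = −μ·ln x, for every s ∈ ℝ one has G(x,s;μ,ρ) ≤ −μ·ln x, and equality holds only when s = μ/x; that is, s = μ/x is the unique global maximizer of s ↦ G(x,s;μ,ρ) and the maximum value is −μ·ln x. -/

import Mathlib

noncomputable def zfun (x s μ ρ : ℝ) : ℝ :=
  (1 / (2 * ρ)) * (Real.sqrt ((s - ρ * x) ^ 2 + 4 * ρ * μ) - (s - ρ * x))

noncomputable def yfun (x s μ ρ : ℝ) : ℝ :=
  (1 / (2 * ρ)) * (Real.sqrt ((s - ρ * x) ^ 2 + 4 * ρ * μ) + (s - ρ * x))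

noncomputable def Gfun (x s μ ρ : ℝ) : ℝ :=
  -μ * Real.log (zfun x s μ ρ) + s * (zfun x s μ ρ - x) + (ρ / 2) * (zfun x s μ ρ - x) ^ 2

theorem zfun_pos {x s μ ρ : ℝ} (hμ : 0 < μ) (hρ : 0 < ρ) : 0 < zfun x s μ ρ := by
  have h : s - ρ * x < Real.sqrt ((s - ρ * x) ^ 2 + 4 * ρ * μ) :=
    Real.lt_sqrt_of_sq_lt (by linarith [mul_pos hρ hμ])
  exact mul_pos (by positivity) (sub_pos.mpr h)

theorem zfun_quadratic {x s μ ρ : ℝ} (hμ : 0 < μ) (hρ : 0 < ρ) :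
    ρ * zfun x s μ ρ ^ 2 + (s - ρ * x) * zfun x s μ ρ = μ := by
  have h := Real.sq_sqrt (show 0 ≤ (s - ρ * x) ^ 2 + 4 * ρ * μ by positivity)
  unfold zfun
  generalize Real.sqrt ((s - ρ * x) ^ 2 + 4 * ρ * μ) = r at h ⊢
  field_simp
  linear_combination h

theorem zfun_eq_self {x μ ρ : ℝ} (hμ : 0 < μ) (hρ : 0 < ρ) (hx : 0 < x) :
    zfun x (μ / x) μ ρ = x := by
  have hz : 0 < zfun x (μ / x) μ ρ := zfun_pos hμ hρ
  have hq : ρ * zfun x (μ / x) μ ρ ^ 2 + (μ / x - ρ * x) * zfun x (μ / x) μ ρ = μ :=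
    zfun_quadratic hμ hρ
  have hpos : ρ * zfun x (μ / x) μ ρ + μ / x ≠ 0 := by positivity
  refine sub_eq_zero.mp ((mul_eq_zero.mp ?_).resolve_right hpos)
  linear_combination hq - div_mul_cancel₀ μ hx.ne'

theorem Gfun_le_sub {x s μ ρ : ℝ} (hμ : 0 < μ) (hρ : 0 < ρ) (hx : 0 < x) :
    Gfun x s μ ρ ≤ -μ * Real.log x - ρ / 2 * (zfun x s μ ρ - x) ^ 2 := by
  have hz : 0 < zfun x s μ ρ := zfun_pos hμ hρ
  have hq : ρ * zfun x s μ ρ ^ 2 + (s - ρ * x) * zfun x s μ ρ = μ := zfun_quadratic hμ hρ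
  unfold Gfun
  generalize zfun x s μ ρ = z at hz hq ⊢
  have hs : s = μ / z - ρ * (z - x) := by
    field_simp
    linear_combination hq
  have hlog := mul_le_mul_of_nonneg_left (Real.log_le_sub_one_of_pos (div_pos hx hz)) hμ.le
  rw [Real.log_div hx.ne' hz.ne'] at hlog
  have hsz : s * (z - x) = -(μ * (x / z - 1)) - ρ * (z - x) ^ 2 := by
    rw [hs]
    field_simp
    ring
  linarith

theorem stmt_13 (μ ρ x : ℝ) (hμ : 0 < μ) (hρ : 0 < ρ) (hx : 0 < x) :
    Gfun x (μ / x) μ ρ = -μ * Real.log x ∧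
    (∀ s : ℝ, Gfun x s μ ρ ≤ -μ * Real.log x) ∧
    (∀ s : ℝ, Gfun x s μ ρ = -μ * Real.log x → s = μ / x) := by
  refine ⟨by simp [Gfun, zfun_eq_self hμ hρ hx], fun s => ?_, fun s hs => ?_⟩
  · have : 0 ≤ ρ / 2 * (zfun x s μ ρ - x) ^ 2 := by positivity
    linarith [Gfun_le_sub (s := s) hμ hρ hx]
  · have hle : ρ / 2 * (zfun x s μ ρ - x) ^ 2 ≤ 0 := by
      linarith [Gfun_le_sub (s := s) hμ hρ hx]
    have hsq : (zfun x s μ ρ - x) ^ 2 = 0 :=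
      le_antisymm (nonpos_of_mul_nonpos_right hle (by positivity)) (sq_nonneg _)
    have hzx : zfun x s μ ρ = x := sub_eq_zero.mp (pow_eq_zero_iff two_ne_zero |>.mp hsq)
    have hq : ρ * zfun x s μ ρ ^ 2 + (s - ρ * x) * zfun x s μ ρ = μ := zfun_quadratic hμ hρ
    rw [hzx] at hq
    rw [eq_div_iff hx.ne']
    linear_combination hq
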